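/- Let ψ be a stopping rule with R(ψ) = ∞. Then R_N(ψ) → ∞ as N → ∞. -/

import Mathlib

open MeasureTheory ENNReal Filter ProbabilityTheory

namespace SDP

variable {Θ X D : Type*} [MeasurableSpace Θ] [MeasurableSpace X] [MeasurableSpace D]

/-- The product measure `μⁿ` on `Xⁿ`. -/
noncomputable def pm (μ : Measure X) (n : ℕ) : Measure (Fin n → X) :=
  Measure.pi fun _ => μ

/-- `t_n^ψ = (1-ψ₁)⋯(1-ψ_{n-1})`, with `t₁^ψ ≡ 1`. -/
noncomputable def t (ψ : ∀ n, (Fin n → X) → ℝ≥0∞) : ∀ n, (Fin n → X) → ℝ≥0∞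
  | 0, _ => 1
  | 1, _ => 1
  | n + 2, x => t ψ (n + 1) (Fin.init x) * (1 - ψ (n + 1) (Fin.init x))

/-- `s_n^ψ = (1-ψ₁)⋯(1-ψ_{n-1})ψ_n`. -/
noncomputable def s (ψ : ∀ n, (Fin n → X) → ℝ≥0∞) (n : ℕ) (x : Fin n → X) : ℝ≥0∞ :=
  t ψ n x * ψ n x

/-- A stopping rule: a sequence of measurable functions with values in `[0,1]`. -/
def IsStoppingRule (ψ : ∀ n, (Fin n → X) → ℝ≥0∞) : Prop :=
  (∀ n, Measurable (ψ n)) ∧ ∀ n x, ψ n x ≤ 1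

/-- A decision rule: a sequence of measurable functions with values in `D`. -/
def IsDecisionRule (δ : ∀ n, (Fin n → X) → D) : Prop := ∀ n, Measurable (δ n)

/-- `ψ` is truncated at `N`: `ψ_n ≡ 1` for all `n ≥ N`. -/
def TruncatedAt (ψ : ∀ n, (Fin n → X) → ℝ≥0∞) (N : ℕ) : Prop :=
  ∀ n, N ≤ n → ∀ x, ψ n x = 1

/-- A consistent family of joint probability densities `f_θⁿ` w.r.t. `μⁿ`. -/
def IsDensityFamily (μ : Measure X) (f : Θ → ∀ n, (Fin n → X) → ℝ≥0∞) : Prop :=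
  (∀ n, Measurable fun p : Θ × (Fin n → X) => f p.1 n p.2) ∧
  (∀ θ x, f θ 0 x = 1) ∧
  (∀ θ n, ∫⁻ x, f θ n x ∂pm μ n = 1) ∧
  ∀ θ n (x : Fin n → X), ∫⁻ y, f θ (n + 1) (Fin.snoc x y) ∂μ = f θ n x

/-- The average loss `W(ψ,δ)`. -/
noncomputable def W (π₁ : Measure Θ) (μ : Measure X) (w : Θ → D → ℝ≥0∞)
    (f : Θ → ∀ n, (Fin n → X) → ℝ≥0∞) (ψ : ∀ n, (Fin n → X) → ℝ≥0∞)
    (δ : ∀ n, (Fin n → X) → D) : ℝ≥0∞ :=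
  ∑' n : ℕ, ∫⁻ θ, ∫⁻ x, s ψ (n + 1) x * w θ (δ (n + 1) x) * f θ (n + 1) x ∂pm μ (n + 1) ∂π₁

/-- The partial average loss `W_i(ψ,δ)` (integration over `Θᵢ`). -/
noncomputable def Wi (π₁ : Measure Θ) (μ : Measure X) (w : Θ → D → ℝ≥0∞)
    (f : Θ → ∀ n, (Fin n → X) → ℝ≥0∞) (Θi : Set Θ) (ψ : ∀ n, (Fin n → X) → ℝ≥0∞)
    (δ : ∀ n, (Fin n → X) → D) : ℝ≥0∞ :=
  ∑' n : ℕ,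
    ∫⁻ θ in Θi, ∫⁻ x, s ψ (n + 1) x * w θ (δ (n + 1) x) * f θ (n + 1) x ∂pm μ (n + 1) ∂π₁

/-- `P^{π}(τ_ψ = n)`. -/
noncomputable def PtauEq (π₂ : Measure Θ) (μ : Measure X)
    (f : Θ → ∀ n, (Fin n → X) → ℝ≥0∞) (ψ : ∀ n, (Fin n → X) → ℝ≥0∞) (n : ℕ) : ℝ≥0∞ :=
  ∫⁻ θ, ∫⁻ x, s ψ n x * f θ n x ∂pm μ n ∂π₂

/-- `P^{π}(τ_ψ < ∞)`. -/
noncomputable def Pfin (π₂ : Measure Θ) (μ : Measure X)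
    (f : Θ → ∀ n, (Fin n → X) → ℝ≥0∞) (ψ : ∀ n, (Fin n → X) → ℝ≥0∞) : ℝ≥0∞ :=
  ∑' n : ℕ, PtauEq π₂ μ f ψ (n + 1)

/-- The average sample number `N(ψ)` (equal to `∞` if `P^{π₂}(τ_ψ < ∞) < 1`). -/
noncomputable def ASN (π₂ : Measure Θ) (μ : Measure X)
    (f : Θ → ∀ n, (Fin n → X) → ℝ≥0∞) (ψ : ∀ n, (Fin n → X) → ℝ≥0∞) : ℝ≥0∞ :=
  if Pfin π₂ μ f ψ = 1 then ∑' n : ℕ, ((n : ℝ≥0∞) + 1) * PtauEq π₂ μ f ψ (n + 1) else ⊤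

/-- `fⁿ = ∫_Θ f_θⁿ dπ₂(θ)` (in particular `f⁰ ≡ 1`). -/
noncomputable def fbar (π₂ : Measure Θ) (f : Θ → ∀ n, (Fin n → X) → ℝ≥0∞)
    (n : ℕ) (x : Fin n → X) : ℝ≥0∞ :=
  ∫⁻ θ, f θ n x ∂π₂

/-- `R(ψ) = Σₙ ∫ sₙ^ψ (c n fⁿ + lₙ) dμⁿ` if `P^{π₂}(τ_ψ<∞) = 1`, `∞` otherwise. -/
noncomputable def R (π₂ : Measure Θ) (μ : Measure X) (c : ℝ≥0∞)
    (f : Θ → ∀ n, (Fin n → X) → ℝ≥0∞) (l : ∀ n, (Fin n → X) → ℝ≥0∞)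
    (ψ : ∀ n, (Fin n → X) → ℝ≥0∞) : ℝ≥0∞ :=
  if Pfin π₂ μ f ψ = 1 then
    ∑' n : ℕ, ∫⁻ x, s ψ (n + 1) x *
      (c * ((n : ℝ≥0∞) + 1) * fbar π₂ f (n + 1) x + l (n + 1) x) ∂pm μ (n + 1)
  else ⊤

/-- `R_N(ψ)`, the risk of `ψ` truncated at `N`. -/
noncomputable def RN (π₂ : Measure Θ) (μ : Measure X) (c : ℝ≥0∞)
    (f : Θ → ∀ n, (Fin n → X) → ℝ≥0∞) (l : ∀ n, (Fin n → X) → ℝ≥0∞)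
    (N : ℕ) (ψ : ∀ n, (Fin n → X) → ℝ≥0∞) : ℝ≥0∞ :=
  (∑ n ∈ Finset.range (N - 1), ∫⁻ x, s ψ (n + 1) x *
      (c * ((n : ℝ≥0∞) + 1) * fbar π₂ f (n + 1) x + l (n + 1) x) ∂pm μ (n + 1)) +
  ∫⁻ x, t ψ N x * (c * (N : ℝ≥0∞) * fbar π₂ f N x + l N x) ∂pm μ N

/-- `Vₙᴺ`, defined backwards from `V_Nᴺ = l_N` by `Vₙᴺ = min{lₙ, Qₙᴺ}`. -/
noncomputable def V (μ : Measure X) (c : ℝ≥0∞) (fb l : ∀ n, (Fin n → X) → ℝ≥0∞)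
    (N n : ℕ) (x : Fin n → X) : ℝ≥0∞ :=
  if h : n < N then
    min (l n x) (c * fb n x + ∫⁻ y, V μ c fb l N (n + 1) (Fin.snoc x y) ∂μ)
  else l n x
termination_by N - n
decreasing_by omega

/-- `Qₙᴺ = c fⁿ + ∫ Vₙ₊₁ᴺ(⋅,y) dμ(y)`. -/
noncomputable def Q (μ : Measure X) (c : ℝ≥0∞) (fb l : ∀ n, (Fin n → X) → ℝ≥0∞)
    (N n : ℕ) (x : Fin n → X) : ℝ≥0∞ :=
  c * fb n x + ∫⁻ y, V μ c fb l N (n + 1) (Fin.snoc x y) ∂μ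

/-- `Vₙ = lim_{N→∞} Vₙᴺ` (the sequence is nonincreasing in `N`, so the limit is the inf). -/
noncomputable def Vlim (μ : Measure X) (c : ℝ≥0∞) (fb l : ∀ n, (Fin n → X) → ℝ≥0∞)
    (n : ℕ) (x : Fin n → X) : ℝ≥0∞ :=
  ⨅ N, V μ c fb l N n x

/-- `Qₙ = lim_{N→∞} Qₙᴺ = c fⁿ + ∫ Vₙ₊₁(⋅,y) dμ(y)`. -/
noncomputable def Qlim (μ : Measure X) (c : ℝ≥0∞) (fb l : ∀ n, (Fin n → X) → ℝ≥0∞)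
    (n : ℕ) (x : Fin n → X) : ℝ≥0∞ :=
  c * fb n x + ∫⁻ y, Vlim μ c fb l (n + 1) (Fin.snoc x y) ∂μ

end SDP

namespace SDP

variable {Θ X : Type*} [MeasurableSpace Θ] [MeasurableSpace X]

instance pm.instSigmaFinite (μ : Measure X) [SigmaFinite μ] (n : ℕ) : SigmaFinite (pm μ n) := by
  unfold pm; infer_instance

lemma measurable_t {ψ : ∀ n, (Fin n → X) → ℝ≥0∞} (hψ : IsStoppingRule ψ) :
    ∀ n, Measurable (t ψ n)
  | 0 => measurable_const
  | 1 => measurable_const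
  | n + 2 => by
    have hinit : Measurable (Fin.init : (Fin (n + 2) → X) → (Fin (n + 1) → X)) :=
      measurable_pi_lambda _ fun i => measurable_pi_apply (Fin.castSucc i)
    exact ((measurable_t hψ (n + 1)).comp hinit).mul
      (measurable_const.sub ((hψ.1 (n + 1)).comp hinit))

lemma measurable_s {ψ : ∀ n, (Fin n → X) → ℝ≥0∞} (hψ : IsStoppingRule ψ) (n : ℕ) :
    Measurable (s ψ n) :=
  (measurable_t hψ n).mul (hψ.1 n)

/-- Integration over `Xⁿ⁺¹` can be performed over the last coordinate first. -/
lemma lintegral_pm_succ (μ : Measure X) [SigmaFinite μ] (n : ℕ)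
    {g : (Fin (n + 1) → X) → ℝ≥0∞} (hg : Measurable g) :
    ∫⁻ x, g x ∂pm μ (n + 1) = ∫⁻ x, ∫⁻ y, g (Fin.snoc x y) ∂μ ∂pm μ n := by
  have hp := (measurePreserving_piFinSuccAbove (fun _ : Fin (n + 1) => μ) (Fin.last n)).symm
  have hmeas : Measurable fun p : X × (Fin n → X) =>
      g ((MeasurableEquiv.piFinSuccAbove (fun _ => X) (Fin.last n)).symm p) :=
    hg.comp (MeasurableEquiv.measurable _)
  unfold pm
  rw [← hp.lintegral_comp hg, lintegral_prod_symm _ hmeas.aemeasurable]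
  simp [MeasurableEquiv.piFinSuccAbove, Fin.insertNthEquiv, Fin.insertNth_last']

/-- The mean of a statistic under the averaged density is the average of its means. -/
lemma lintegral_mul_fbar {μ : Measure X} [SigmaFinite μ] {π : Measure Θ} [IsProbabilityMeasure π]
    {f : Θ → ∀ n, (Fin n → X) → ℝ≥0∞} (hf : IsDensityFamily μ f) (n : ℕ)
    {g : (Fin n → X) → ℝ≥0∞} (hg : Measurable g) :
    ∫⁻ x, g x * fbar π f n x ∂pm μ n = ∫⁻ θ, ∫⁻ x, g x * f θ n x ∂pm μ n ∂π := by
  rw [lintegral_lintegral_swap ((hg.comp measurable_snd).mul (hf.1 n)).aemeasurable]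
  refine lintegral_congr fun x => ?_
  exact (lintegral_const_mul _ ((hf.1 n).comp measurable_prodMk_right)).symm

/-- At each stage `n ≥ 1`, the probability of having continued so far splits into the
probability of stopping now and that of continuing. -/
lemma lintegral_t_eq_add {μ : Measure X} [SigmaFinite μ]
    {f : Θ → ∀ n, (Fin n → X) → ℝ≥0∞} (hf : IsDensityFamily μ f)
    {ψ : ∀ n, (Fin n → X) → ℝ≥0∞} (hψ : IsStoppingRule ψ) (θ : Θ) (n : ℕ) :
    ∫⁻ x, t ψ (n + 1) x * f θ (n + 1) x ∂pm μ (n + 1) =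
      ∫⁻ x, s ψ (n + 1) x * f θ (n + 1) x ∂pm μ (n + 1) +
      ∫⁻ x, t ψ (n + 2) x * f θ (n + 2) x ∂pm μ (n + 2) := by
  have hfm (m : ℕ) : Measurable (f θ m) := (hf.1 m).comp measurable_prodMk_left
  have hsnoc (x : Fin (n + 1) → X) :
      Measurable fun y : X => (Fin.snoc x y : Fin (n + 2) → X) := by
    refine measurable_pi_lambda _ fun i => ?_
    induction i using Fin.lastCases with
    | last => simpa using measurable_id'
    | cast i => simp
  have hg : Measurable fun x => t ψ (n + 2) x * f θ (n + 2) x :=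
    (measurable_t hψ (n + 2)).mul (hfm (n + 2))
  have hy (x : Fin (n + 1) → X) : Measurable fun y => f θ (n + 2) (Fin.snoc x y) :=
    (hfm (n + 2)).comp (hsnoc x)
  have hs : Measurable fun x => s ψ (n + 1) x * f θ (n + 1) x :=
    (measurable_s hψ (n + 1)).mul (hfm (n + 1))
  rw [lintegral_pm_succ μ (n + 1) hg, ← lintegral_add_left hs]
  refine lintegral_congr fun x => ?_
  simp only [t, Fin.init_snoc]
  rw [lintegral_const_mul _ (hy x), hf.2.2.2, s, ← add_mul, ← mul_add,
    add_tsub_cancel_of_le (hψ.2 _ x), mul_one]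

lemma sum_PtauEq_add_lintegral_t {μ : Measure X} [SigmaFinite μ]
    {π : Measure Θ} [IsProbabilityMeasure π]
    {f : Θ → ∀ n, (Fin n → X) → ℝ≥0∞} (hf : IsDensityFamily μ f)
    {ψ : ∀ n, (Fin n → X) → ℝ≥0∞} (hψ : IsStoppingRule ψ) (N : ℕ) :
    ∑ n ∈ Finset.range N, PtauEq π μ f ψ (n + 1) +
      ∫⁻ x, t ψ (N + 1) x * fbar π f (N + 1) x ∂pm μ (N + 1) = 1 := by
  induction N with
  | zero =>
    rw [lintegral_mul_fbar hf _ (measurable_t hψ _)]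
    simp [t, hf.2.2.1]
  | succ N ih =>
    rw [Finset.sum_range_succ, add_assoc]
    refine Eq.trans ?_ ih
    congr 1
    have hm : Measurable fun p : Θ × (Fin (N + 1) → X) => s ψ (N + 1) p.2 * f p.1 (N + 1) p.2 :=
      ((measurable_s hψ (N + 1)).comp measurable_snd).mul (hf.1 (N + 1))
    rw [lintegral_mul_fbar hf _ (measurable_t hψ _), lintegral_mul_fbar hf _ (measurable_t hψ _),
      PtauEq, ← lintegral_add_left hm.lintegral_prod_right']
    exact lintegral_congr fun θ => (lintegral_t_eq_add hf hψ θ N).symm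

lemma Pfin_le_one {μ : Measure X} [SigmaFinite μ]
    {π : Measure Θ} [IsProbabilityMeasure π]
    {f : Θ → ∀ n, (Fin n → X) → ℝ≥0∞} (hf : IsDensityFamily μ f)
    {ψ : ∀ n, (Fin n → X) → ℝ≥0∞} (hψ : IsStoppingRule ψ) : Pfin π μ f ψ ≤ 1 :=
  ENNReal.tsum_le_of_sum_range_le fun N =>
    le_self_add.trans (sum_PtauEq_add_lintegral_t hf hψ N).le

lemma one_sub_Pfin_le {μ : Measure X} [SigmaFinite μ]
    {π : Measure Θ} [IsProbabilityMeasure π]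
    {f : Θ → ∀ n, (Fin n → X) → ℝ≥0∞} (hf : IsDensityFamily μ f)
    {ψ : ∀ n, (Fin n → X) → ℝ≥0∞} (hψ : IsStoppingRule ψ) (N : ℕ) :
    1 - Pfin π μ f ψ ≤ ∫⁻ x, t ψ (N + 1) x * fbar π f (N + 1) x ∂pm μ (N + 1) := by
  rw [tsub_le_iff_left, ← sum_PtauEq_add_lintegral_t (π := π) hf hψ N]
  gcongr
  exact ENNReal.sum_le_tsum _

end SDP

open SDP MeasureTheory ENNReal Filter in
/-- if `R(ψ) = ∞` then `R_N(ψ) → ∞` as `N → ∞`. -/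
theorem statement_11
    {Θ X D : Type*} [MeasurableSpace Θ] [MeasurableSpace X] [MeasurableSpace D]
    (μ : Measure X) [SigmaFinite μ]
    (π₁ π₂ : Measure Θ) [IsProbabilityMeasure π₁] [IsProbabilityMeasure π₂]
    (f : Θ → ∀ n, (Fin n → X) → ℝ≥0∞) (hf : IsDensityFamily μ f)
    (w : Θ → D → ℝ≥0∞) (hw : Measurable (Function.uncurry w))
    (δB : ∀ n, (Fin n → X) → D) (hδB : IsDecisionRule δB)
    (hBayes : ∀ n (d : D), ∀ᵐ x ∂pm μ n,
      ∫⁻ θ, w θ (δB n x) * f θ n x ∂π₁ ≤ ∫⁻ θ, w θ d * f θ n x ∂π₁)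
    (l : ∀ n, (Fin n → X) → ℝ≥0∞)
    (hl : ∀ n x, l n x = ∫⁻ θ, w θ (δB n x) * f θ n x ∂π₁)
    (hl1 : ∫⁻ x, l 1 x ∂pm μ 1 < ⊤)
    (c : ℝ≥0∞) (hc : 0 < c) (hc' : c ≠ ⊤)
    (ψ : ∀ n, (Fin n → X) → ℝ≥0∞) (hψ : IsStoppingRule ψ)
    (hinf : R π₂ μ c f l ψ = ⊤) :
    Tendsto (fun N => RN π₂ μ c f l N ψ) atTop (nhds ⊤) := by
  rw [← tendsto_add_atTop_iff_nat 1]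
  by_cases hP : Pfin π₂ μ f ψ = 1
  · rw [R, if_pos hP] at hinf
    have hsum := ENNReal.tendsto_nat_tsum fun n : ℕ => ∫⁻ x, s ψ (n + 1) x *
      (c * ((n : ℝ≥0∞) + 1) * fbar π₂ f (n + 1) x + l (n + 1) x) ∂pm μ (n + 1)
    rw [hinf] at hsum
    exact tendsto_of_tendsto_of_tendsto_of_le_of_le hsum tendsto_const_nhds
      (fun N => le_self_add) fun N => le_top
  · have hε : 1 - Pfin π₂ μ f ψ ≠ 0 :=
      (tsub_pos_of_lt (lt_of_le_of_ne (Pfin_le_one hf hψ) hP)).ne'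
    have hlim : Tendsto (fun N : ℕ => c * ((N + 1 : ℕ) : ℝ≥0∞) * (1 - Pfin π₂ μ f ψ))
        atTop (nhds ⊤) := by
      have hN : Tendsto (fun N : ℕ => ((N + 1 : ℕ) : ℝ≥0∞)) atTop (nhds ⊤) :=
        ENNReal.tendsto_nat_nhds_top.comp (tendsto_add_atTop_nat 1)
      have h := ENNReal.Tendsto.mul_const (b := 1 - Pfin π₂ μ f ψ)
        (ENNReal.Tendsto.const_mul (a := c) hN (Or.inl top_ne_zero))
        (Or.inl (by simp [hc.ne']))
      rwa [ENNReal.mul_top hc.ne', ENNReal.top_mul hε] at h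
    refine tendsto_of_tendsto_of_tendsto_of_le_of_le hlim tendsto_const_nhds
      (fun N => ?_) fun N => le_top
    calc c * ((N + 1 : ℕ) : ℝ≥0∞) * (1 - Pfin π₂ μ f ψ)
        ≤ c * ((N + 1 : ℕ) : ℝ≥0∞) *
            ∫⁻ x, t ψ (N + 1) x * fbar π₂ f (N + 1) x ∂pm μ (N + 1) := by
          gcongr
          exact one_sub_Pfin_le hf hψ N
      _ = ∫⁻ x, c * ((N + 1 : ℕ) : ℝ≥0∞) * (t ψ (N + 1) x * fbar π₂ f (N + 1) x)
            ∂pm μ (N + 1) :=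
          (lintegral_const_mul' _ _ (ENNReal.mul_ne_top hc' (ENNReal.natCast_ne_top _))).symm
      _ ≤ ∫⁻ x, t ψ (N + 1) x * (c * ((N + 1 : ℕ) : ℝ≥0∞) * fbar π₂ f (N + 1) x
            + l (N + 1) x) ∂pm μ (N + 1) := by
          refine lintegral_mono fun x => ?_
          rw [mul_left_comm]
          gcongr
          exact le_self_add
      _ ≤ RN π₂ μ c f l (N + 1) ψ := le_add_self
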